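/- Let σ be a primitive, non-erasing, well-marked substitution over 𝔸 = {a,b} whose fixed point ξ is not ultimately periodic, with A·B ≠ B·A and W_0, T as in the context. Then there exists L ∈ ℕ such that every left special factor W of ξ is a prefix of Tⁿ(W′) for some n ∈ ℕ and some left special factor W′ of ξ with |W′| ≤ L. -/

import Mathlib

namespace Subst

/-- `pow A m` is the `m`-fold concatenation `A^m`. -/
def pow (A : List Bool) : ℕ → List Bool
  | 0 => []
  | n + 1 => pow A n ++ A

/-- Membership in the submonoid of `𝔸*` generated by `{A, B}`. -/
inductive GenAB (A B : List Bool) : List Bool → Prop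
  | nil : GenAB A B []
  | appA : ∀ {W}, GenAB A B W → GenAB A B (W ++ A)
  | appB : ∀ {W}, GenAB A B W → GenAB A B (W ++ B)

/-- The extension of a substitution `σ : 𝔸 → 𝔸*` to a monoid morphism of `𝔸*`. -/
def subst (σ : Bool → List Bool) : List Bool → List Bool
  | [] => []
  | c :: w => σ c ++ subst σ w

/-- The factor `ξ[i, i+n)` of the infinite sequence `ξ`. -/
def wordAt (ξ : ℕ → Bool) (i n : ℕ) : List Bool :=
  (List.range n).map fun k => ξ (i + k)

/-- `W` is a factor of the infinite sequence `ξ`. -/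
def IsFactor (ξ : ℕ → Bool) (W : List Bool) : Prop :=
  ∃ i, W = wordAt ξ i W.length

/-- `ξ` is a fixed point of `σ`: for every `n`, `σ(ξ[0,n))` is a prefix of `ξ`. -/
def IsFixedPoint (σ : Bool → List Bool) (ξ : ℕ → Bool) : Prop :=
  ∀ n, subst σ (wordAt ξ 0 n) = wordAt ξ 0 (subst σ (wordAt ξ 0 n)).length

/-- `ξ` is recurrent: every factor occurs at infinitely many positions. -/
def Recurrent (ξ : ℕ → Bool) : Prop :=
  ∀ W, IsFactor ξ W → ∀ N, ∃ i, N ≤ i ∧ W = wordAt ξ i W.length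

/-- `ξ` is ultimately periodic. -/
def UltPeriodic (ξ : ℕ → Bool) : Prop :=
  ∃ p, 1 ≤ p ∧ ∃ N, ∀ n, N ≤ n → ξ (n + p) = ξ n

/-- `σ` is non-erasing: the image of each letter is nonempty. -/
def NonErasing (σ : Bool → List Bool) : Prop := ∀ c, σ c ≠ []

/-- `σ` is well-marked: `σ(c)` begins with the letter `c` for each letter `c`. -/
def WellMarked (σ : Bool → List Bool) : Prop := ∀ c, ∃ t, σ c = c :: t

/-- `σ` is primitive: for some `n ≥ 1`, each letter occurs in `σⁿ(d)` for each letter `d`. -/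
def Primitive (σ : Bool → List Bool) : Prop :=
  ∃ n, 1 ≤ n ∧ ∀ c d : Bool, c ∈ (subst σ)^[n] [d]

/-- `W` is a right special factor of `ξ`: both `Wa` and `Wb` are factors of `ξ`. -/
def RightSpecial (ξ : ℕ → Bool) (W : List Bool) : Prop :=
  ∀ c : Bool, IsFactor ξ (W ++ [c])

/-- `W` is a left special factor of `ξ`: both `aW` and `bW` are factors of `ξ`. -/
def LeftSpecial (ξ : ℕ → Bool) (W : List Bool) : Prop :=
  ∀ c : Bool, IsFactor ξ (c :: W)

/-- A right special factor is strong if all of `aWa, aWb, bWa, bWb` are factors. -/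
def StrongSpecial (ξ : ℕ → Bool) (W : List Bool) : Prop :=
  ∀ c d : Bool, IsFactor ξ (c :: (W ++ [d]))

/-- A right special factor is weak if neither `aW` nor `bW` is right special. -/
def WeakSpecial (ξ : ℕ → Bool) (W : List Bool) : Prop :=
  RightSpecial ξ W ∧ ∀ c : Bool, ¬ RightSpecial ξ (c :: W)

/-- The operator `T(W) = W₀ · σ(W)`. -/
def T (σ : Bool → List Bool) (W0 W : List Bool) : List Bool := W0 ++ subst σ W

/-- Specification of the word `W₀` (the longest common suffix of `A^∞` and `B^∞`)
together with the distinct letters `δ_a, δ_b`:  `δ_c · W₀` is a suffix of some power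
of `σ(c)` for each letter `c`, and `δ_a ≠ δ_b`. -/
def W0Spec (σ : Bool → List Bool) (W0 : List Bool) (δ : Bool → Bool) : Prop :=
  δ false ≠ δ true ∧ ∀ c, ∃ m, 1 ≤ m ∧ (δ c :: W0) <:+ pow (σ c) m

/-- The incidence matrix of `σ`: its columns are the Parikh vectors of `σ(a)` and `σ(b)`. -/
def incMat (σ : Bool → List Bool) : Matrix Bool Bool ℤ :=
  Matrix.of fun c d => ((σ d).count c : ℤ)

end Subst

open Subst

namespace Subst

variable {σ : Bool → List Bool} {ξ : ℕ → Bool}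

/-! ### Words and morphisms -/

@[simp]
lemma length_wordAt (ξ : ℕ → Bool) (i n : ℕ) : (wordAt ξ i n).length = n := by
  simp [wordAt]

lemma wordAt_add (ξ : ℕ → Bool) (i m n : ℕ) :
    wordAt ξ i (m + n) = wordAt ξ i m ++ wordAt ξ (i + m) n := by
  simp [wordAt, List.range_add, Function.comp_def, add_assoc]

@[simp]
lemma wordAt_one (ξ : ℕ → Bool) (i : ℕ) : wordAt ξ i 1 = [ξ i] := by
  simp [wordAt]

lemma wordAt_succ (ξ : ℕ → Bool) (i n : ℕ) :
    wordAt ξ i (n + 1) = wordAt ξ i n ++ [ξ (i + n)] := by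
  rw [wordAt_add, wordAt_one]

lemma wordAt_succ' (ξ : ℕ → Bool) (i n : ℕ) :
    wordAt ξ i (n + 1) = ξ i :: wordAt ξ (i + 1) n := by
  rw [add_comm n 1, wordAt_add, wordAt_one, List.singleton_append]

lemma getElem?_wordAt (ξ : ℕ → Bool) (i : ℕ) {n t : ℕ} (h : t < n) :
    (wordAt ξ i n)[t]? = some (ξ (i + t)) := by
  simp [wordAt, h]

lemma wordAt_eq_iff (ξ : ℕ → Bool) (i j n : ℕ) :
    wordAt ξ i n = wordAt ξ j n ↔ ∀ t < n, ξ (i + t) = ξ (j + t) := by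
  simp [wordAt]

lemma wordAt_prefix (ξ : ℕ → Bool) (i : ℕ) {m n : ℕ} (h : m ≤ n) :
    wordAt ξ i m <+: wordAt ξ i n := by
  rw [← Nat.add_sub_cancel' h, wordAt_add]
  exact List.prefix_append _ _

lemma isFactor_wordAt (ξ : ℕ → Bool) (i n : ℕ) : IsFactor ξ (wordAt ξ i n) :=
  ⟨i, by simp⟩

/-- A suffix of the prefix of `ξ` of length `n` is the factor of `ξ` ending at position `n`. -/
lemma eq_wordAt_of_suffix {V : List Bool} {n : ℕ} (h : V <:+ wordAt ξ 0 n) :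
    V.length ≤ n ∧ V = wordAt ξ (n - V.length) V.length := by
  have hl : V.length ≤ n := by simpa using h.length_le
  refine ⟨hl, ?_⟩
  have h' : wordAt ξ (n - V.length) V.length <:+ wordAt ξ 0 n := by
    refine ⟨wordAt ξ 0 (n - V.length), ?_⟩
    have := wordAt_add ξ 0 (n - V.length) V.length
    rw [Nat.sub_add_cancel hl, zero_add] at this
    exact this.symm
  exact (List.suffix_of_suffix_length_le h h' (by simp)).eq_of_length (by simp)

lemma subst_append (σ : Bool → List Bool) (u v : List Bool) :
    subst σ (u ++ v) = subst σ u ++ subst σ v := by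
  induction u with
  | nil => rfl
  | cons c u ih => simp [subst, ih]

@[simp]
lemma subst_singleton (σ : Bool → List Bool) (c : Bool) : subst σ [c] = σ c := by
  simp [subst]

lemma iterate_subst_append (σ : Bool → List Bool) (K : ℕ) (u v : List Bool) :
    (subst σ)^[K] (u ++ v) = (subst σ)^[K] u ++ (subst σ)^[K] v := by
  induction K generalizing u v with
  | zero => rfl
  | succ K ih => simp [Function.iterate_succ_apply, subst_append, ih]

lemma iterate_subst_nil (σ : Bool → List Bool) (K : ℕ) : (subst σ)^[K] [] = [] :=
  Function.iterate_fixed rfl K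

/-- The iterate `σ^K` of a substitution, as a substitution. -/
def iterSubst (σ : Bool → List Bool) (K : ℕ) (c : Bool) : List Bool := (subst σ)^[K] [c]

lemma subst_iterSubst (σ : Bool → List Bool) (K : ℕ) (w : List Bool) :
    subst (iterSubst σ K) w = (subst σ)^[K] w := by
  induction w with
  | nil => simp [subst, iterate_subst_nil]
  | cons c w ih =>
    rw [subst, ih, ← List.singleton_append, iterate_subst_append, iterSubst]

lemma IsFixedPoint.iterate (hfix : IsFixedPoint σ ξ) (K : ℕ) :
    IsFixedPoint (iterSubst σ K) ξ := by
  intro n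
  rw [subst_iterSubst]
  induction K with
  | zero => simp
  | succ K ih =>
    rw [Function.iterate_succ_apply', ih]
    exact hfix _

lemma WellMarked.two_le_length (hwm : WellMarked σ) (hprim : Primitive σ) (c : Bool) :
    2 ≤ (σ c).length := by
  obtain ⟨t, ht⟩ := hwm c
  by_contra hlt
  have ht0 : t = [] := by
    rw [← List.length_eq_zero_iff]
    simp [ht] at hlt
    simp [hlt]
  obtain ⟨n, -, hn⟩ := hprim
  have hmem := hn (!c) c
  rw [Function.iterate_fixed (by simp [ht, ht0])] at hmem
  simp at hmem

lemma two_mul_length_le_subst (h2 : ∀ c, 2 ≤ (σ c).length) (w : List Bool) :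
    2 * w.length ≤ (subst σ w).length := by
  induction w with
  | nil => simp
  | cons c w ih =>
    have := h2 c
    simp only [subst, List.length_cons, List.length_append]
    omega

lemma lt_length_iterSubst (h2 : ∀ c, 2 ≤ (σ c).length) (K : ℕ) (c : Bool) :
    K < (iterSubst σ K c).length := by
  induction K with
  | zero => simp [iterSubst]
  | succ K ih =>
    rw [iterSubst] at ih ⊢
    rw [Function.iterate_succ_apply']
    have := two_mul_length_le_subst h2 ((subst σ)^[K] [c])
    omega

/-! ### Cutting points -/

/-- The `k`-th cutting point `|σ(ξ[0,k))|`. -/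
def cut (σ : Bool → List Bool) (ξ : ℕ → Bool) (k : ℕ) : ℕ := (subst σ (wordAt ξ 0 k)).length

@[simp]
lemma cut_zero : cut σ ξ 0 = 0 := rfl

lemma cut_add (k h : ℕ) : cut σ ξ (k + h) = cut σ ξ k + (subst σ (wordAt ξ k h)).length := by
  simp [cut, wordAt_add, subst_append]

lemma cut_succ (k : ℕ) : cut σ ξ (k + 1) = cut σ ξ k + (σ (ξ k)).length := by
  simp [cut_add]

lemma IsFixedPoint.subst_wordAt (hfix : IsFixedPoint σ ξ) (k h : ℕ) :
    subst σ (wordAt ξ k h) = wordAt ξ (cut σ ξ k) (subst σ (wordAt ξ k h)).length := by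
  have h1 := hfix (k + h)
  have h0 := hfix k
  rw [← cut] at h0 h1
  rw [cut_add, wordAt_add, wordAt_add, zero_add, zero_add, subst_append, h0] at h1
  exact List.append_cancel_left h1

lemma IsFixedPoint.map_letter (hfix : IsFixedPoint σ ξ) (k : ℕ) :
    σ (ξ k) = wordAt ξ (cut σ ξ k) (σ (ξ k)).length := by
  simpa using hfix.subst_wordAt k 1

lemma IsFixedPoint.getElem?_map_letter (hfix : IsFixedPoint σ ξ) (k : ℕ) {r : ℕ}
    (hr : r < (σ (ξ k)).length) : (σ (ξ k))[r]? = some (ξ (cut σ ξ k + r)) := by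
  rw [hfix.map_letter k, getElem?_wordAt _ _ hr]

lemma IsFixedPoint.apply_cut (hfix : IsFixedPoint σ ξ) (hwm : WellMarked σ) (k : ℕ) :
    ξ (cut σ ξ k) = ξ k := by
  obtain ⟨t, ht⟩ := hwm (ξ k)
  have := hfix.getElem?_map_letter k (r := 0) (by simp [ht])
  simpa [ht] using this.symm

lemma le_cut (hpos : ∀ c, 1 ≤ (σ c).length) (k : ℕ) : k ≤ cut σ ξ k := by
  induction k with
  | zero => simp
  | succ k ih =>
    rw [cut_succ]
    have := hpos (ξ k)
    omega

lemma exists_cut_mem_window {M : ℕ} (hpos : ∀ c, 1 ≤ (σ c).length)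
    (hM : ∀ c, (σ c).length ≤ M) (i : ℕ) : ∃ k, i ≤ cut σ ξ k ∧ cut σ ξ k < i + M := by
  classical
  have hex : ∃ k, i ≤ cut σ ξ k := ⟨i, le_cut hpos i⟩
  refine ⟨Nat.find hex, Nat.find_spec hex, ?_⟩
  have h1 := hpos true
  have h2 := hM true
  rcases hk : Nat.find hex with _ | k
  · simp only [cut_zero]
    omega
  · have hlt := Nat.find_min hex (m := k) (by omega)
    have := hM (ξ k)
    rw [cut_succ]
    omega

/-! ### Uniform recurrence -/

lemma IsFixedPoint.prefix_infix_iterate (hfix : IsFixedPoint σ ξ) (h2 : ∀ c, 2 ≤ (σ c).length)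
    {m : ℕ} (hm : ∀ c d : Bool, c ∈ (subst σ)^[m] [d]) (n : ℕ) (d : Bool) :
    wordAt ξ 0 n <:+: iterSubst σ (n + m) d := by
  obtain ⟨u, v, huv⟩ := List.append_of_mem (hm (ξ 0) d)
  have hlen := lt_length_iterSubst h2 n (ξ 0)
  have hpre : wordAt ξ 0 n <+: iterSubst σ n (ξ 0) := by
    have h := (hfix.iterate n) 1
    simp only [wordAt_one, subst_singleton] at h
    rw [h]
    exact wordAt_prefix ξ 0 hlen.le
  have hinf : iterSubst σ n (ξ 0) <:+: iterSubst σ (n + m) d := by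
    refine ⟨(subst σ)^[n] u, (subst σ)^[n] v, ?_⟩
    rw [iterSubst, iterSubst, Function.iterate_add_apply, huv,
      ← List.singleton_append (l := v), iterate_subst_append, iterate_subst_append,
      List.append_assoc]
  exact hpre.isInfix.trans hinf

/-- Every prefix of `ξ` occurs in every sufficiently long window of `ξ`. -/
lemma IsFixedPoint.exists_window (hfix : IsFixedPoint σ ξ) (h2 : ∀ c, 2 ≤ (σ c).length)
    (hprim : Primitive σ) (n : ℕ) :
    ∃ R, ∀ i, ∃ j, i ≤ j ∧ j + n ≤ i + R ∧ ∀ t < n, ξ (j + t) = ξ t := by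
  obtain ⟨m, -, hm⟩ := hprim
  set τ := iterSubst σ (n + m) with hτ
  have hτfix : IsFixedPoint τ ξ := hfix.iterate _
  set M := (τ false).length + (τ true).length
  have hM : ∀ c, (τ c).length ≤ M := by
    intro c
    cases c <;> simp [M]
  have hpos : ∀ c, 1 ≤ (τ c).length := fun c =>
    (Nat.zero_le _).trans_lt (lt_length_iterSubst h2 (n + m) c)
  refine ⟨2 * M, fun i => ?_⟩
  obtain ⟨k, hk1, hk2⟩ := exists_cut_mem_window (ξ := ξ) hpos hM i
  obtain ⟨u, v, huv⟩ := hfix.prefix_infix_iterate h2 hm n (ξ k)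
  rw [← hτ] at huv
  have hl := congrArg List.length huv
  simp only [List.length_append, length_wordAt] at hl
  have hMk := hM (ξ k)
  refine ⟨cut τ ξ k + u.length, by omega, by omega, fun t ht => ?_⟩
  have h1 := hτfix.getElem?_map_letter k (r := u.length + t) (by omega)
  rw [← huv, List.append_assoc, List.getElem?_append_right (by omega), Nat.add_sub_cancel_left,
    List.getElem?_append_left (by simpa using ht), getElem?_wordAt _ _ ht] at h1
  simpa [add_assoc] using h1.symm

lemma IsFixedPoint.exists_period_break (hfix : IsFixedPoint σ ξ) (h2 : ∀ c, 2 ≤ (σ c).length)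
    (hprim : Primitive σ) (hnp : ¬ UltPeriodic ξ) (p : ℕ) :
    ∃ N, 1 ≤ p → ∀ i, ∃ t < N, ξ (i + t + p) ≠ ξ (i + t) := by
  by_cases hp : 1 ≤ p
  · have : ∃ n, ξ (n + p) ≠ ξ n := by
      by_contra! h
      exact hnp ⟨p, hp, 0, fun n _ => h n⟩
    obtain ⟨n, hn⟩ := this
    obtain ⟨R, hR⟩ := hfix.exists_window h2 hprim (n + p + 1)
    refine ⟨R, fun _ i => ?_⟩
    obtain ⟨j, hij, hjR, hj⟩ := hR i
    refine ⟨j - i + n, by omega, ?_⟩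
    have e : i + (j - i + n) = j + n := by omega
    rw [e, add_assoc, hj _ (by omega), hj _ (by omega)]
    exact hn
  · exact ⟨0, fun h => absurd h hp⟩

lemma IsFixedPoint.exists_late_occurrence (hfix : IsFixedPoint σ ξ)
    (h2 : ∀ c, 2 ≤ (σ c).length) (hprim : Primitive σ) {W : List Bool} (hW : IsFactor ξ W)
    (N : ℕ) : ∃ i, N ≤ i ∧ W = wordAt ξ i W.length := by
  obtain ⟨i, hi⟩ := hW
  obtain ⟨R, hR⟩ := hfix.exists_window h2 hprim (i + W.length)
  obtain ⟨j, hNj, -, hj⟩ := hR N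
  refine ⟨j + i, by omega, ?_⟩
  rw [wordAt_eq_iff ξ i (j + i) W.length |>.2 fun t ht => by
    rw [add_assoc, hj _ (by omega)]] at hi
  exact hi

/-! ### Synchronization -/

/-- `loc σ ξ n = (r, k)` when position `n` is the `r`-th letter of the block `σ(ξ k)`. -/
def loc (σ : Bool → List Bool) (ξ : ℕ → Bool) : ℕ → ℕ × ℕ
  | 0 => (0, 0)
  | n + 1 =>
    if (loc σ ξ n).1 + 1 < (σ (ξ (loc σ ξ n).2)).length then
      ((loc σ ξ n).1 + 1, (loc σ ξ n).2)
    else (0, (loc σ ξ n).2 + 1)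

lemma loc_spec (hpos : ∀ c, 1 ≤ (σ c).length) (n : ℕ) :
    cut σ ξ (loc σ ξ n).2 + (loc σ ξ n).1 = n ∧
      (loc σ ξ n).1 < (σ (ξ (loc σ ξ n).2)).length := by
  induction n with
  | zero => exact ⟨by simp [loc], hpos _⟩
  | succ n ih =>
    rw [loc]
    split_ifs with h
    · exact ⟨by simp only; omega, h⟩
    · refine ⟨?_, hpos _⟩
      simp only [cut_succ]
      omega

/-- The offset of position `n` in its block, with the letter whose image the block is. -/
def state (σ : Bool → List Bool) (ξ : ℕ → Bool) (n : ℕ) : ℕ × Bool :=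
  ((loc σ ξ n).1, ξ (loc σ ξ n).2)

lemma IsFixedPoint.getElem?_state (hfix : IsFixedPoint σ ξ) (hpos : ∀ c, 1 ≤ (σ c).length)
    (n : ℕ) : (σ (state σ ξ n).2)[(state σ ξ n).1]? = some (ξ n) := by
  obtain ⟨h1, h2⟩ := loc_spec (σ := σ) (ξ := ξ) hpos n
  have := hfix.getElem?_map_letter _ h2
  rwa [h1] at this

lemma IsFixedPoint.apply_eq_of_state_eq (hfix : IsFixedPoint σ ξ)
    (hpos : ∀ c, 1 ≤ (σ c).length) {n n' : ℕ} (h : state σ ξ n = state σ ξ n') :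
    ξ n = ξ n' := by
  have h1 := hfix.getElem?_state hpos n
  rw [h, hfix.getElem?_state hpos n'] at h1
  simpa using h1.symm

lemma IsFixedPoint.state_succ (hfix : IsFixedPoint σ ξ) (hwm : WellMarked σ)
    (hpos : ∀ c, 1 ≤ (σ c).length) (n : ℕ) :
    state σ ξ (n + 1) = if (state σ ξ n).1 + 1 < (σ (state σ ξ n).2).length then
      ((state σ ξ n).1 + 1, (state σ ξ n).2) else (0, ξ (n + 1)) := by
  have h := (loc_spec (σ := σ) (ξ := ξ) hpos (n + 1)).1
  split_ifs with h1 <;> simp only [state] at h1 ⊢ <;> rw [loc] at h ⊢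
  · rw [if_pos h1]
  · rw [if_neg h1] at h ⊢
    rw [← h, add_zero, hfix.apply_cut hwm]

lemma IsFixedPoint.state_succ_eq (hfix : IsFixedPoint σ ξ) (hwm : WellMarked σ)
    (hpos : ∀ c, 1 ≤ (σ c).length) {n n' m m' : ℕ} (hn : state σ ξ n = state σ ξ n')
    (hm : state σ ξ m = state σ ξ m') (hξ : ξ (n + 1) = ξ (m + 1))
    (hξ' : ξ (n' + 1) = ξ (m' + 1))
    (hns : ¬ ((state σ ξ (n + 1)).1 = 0 ∧ (state σ ξ (m + 1)).1 = 0)) :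
    state σ ξ (n + 1) = state σ ξ (n' + 1) ∧ state σ ξ (m + 1) = state σ ξ (m' + 1) := by
  have en := hfix.state_succ hwm hpos n
  have en' := hfix.state_succ hwm hpos n'
  have em := hfix.state_succ hwm hpos m
  have em' := hfix.state_succ hwm hpos m'
  rw [← hn] at en'
  rw [← hm] at em'
  by_cases c1 : (state σ ξ n).1 + 1 < (σ (state σ ξ n).2).length
  · rw [if_pos c1] at en en'
    have e1 := en.trans en'.symm
    refine ⟨e1, ?_⟩
    by_cases c2 : (state σ ξ m).1 + 1 < (σ (state σ ξ m).2).length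
    · rw [if_pos c2] at em em'
      exact em.trans em'.symm
    · rw [if_neg c2] at em em'
      rw [em, em', ← hξ, ← hξ', hfix.apply_eq_of_state_eq hpos e1]
  · rw [if_neg c1] at en en'
    by_cases c2 : (state σ ξ m).1 + 1 < (σ (state σ ξ m).2).length
    · rw [if_pos c2] at em em'
      have e1 := em.trans em'.symm
      refine ⟨?_, e1⟩
      rw [en, en', hξ, hξ', hfix.apply_eq_of_state_eq hpos e1]
    · rw [if_neg c2] at em
      exact absurd ⟨by rw [en], by rw [em]⟩ hns

/-- Two occurrences of a sufficiently long factor have a cutting point in common. -/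
lemma IsFixedPoint.exists_common_cut (hfix : IsFixedPoint σ ξ) (hwm : WellMarked σ)
    (hprim : Primitive σ) (hnp : ¬ UltPeriodic ξ) :
    ∃ N, ∀ i j, (∀ t < N, ξ (i + t) = ξ (j + t)) →
      ∃ t < N, ∃ k l, cut σ ξ k = i + t ∧ cut σ ξ l = j + t := by
  have h2 := hwm.two_le_length hprim
  have hpos : ∀ c, 1 ≤ (σ c).length := fun c => one_le_two.trans (h2 c)
  choose P hP using hfix.exists_period_break h2 hprim hnp
  set M := (σ false).length + (σ true).length
  have hM : ∀ c, (σ c).length ≤ M := by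
    intro c
    cases c <;> simp [M]
  set F : Finset (ℕ × Bool) := Finset.range M ×ˢ Finset.univ
  have hF : ∀ n, state σ ξ n ∈ F := fun n => by
    have := (loc_spec (σ := σ) (ξ := ξ) hpos n).2.trans_le (hM _)
    simpa [F, state] using this
  set K := (F ×ˢ F).card
  refine ⟨K + ∑ p ∈ Finset.range (K + 1), P p + 1, fun i j hij => ?_⟩
  set N := K + ∑ p ∈ Finset.range (K + 1), P p + 1
  by_contra! hno
  have hns : ∀ t < N, ¬ ((state σ ξ (i + t)).1 = 0 ∧ (state σ ξ (j + t)).1 = 0) := by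
    rintro t ht ⟨h1, h2⟩
    have e1 := (loc_spec (σ := σ) (ξ := ξ) hpos (i + t)).1
    have e2 := (loc_spec (σ := σ) (ξ := ξ) hpos (j + t)).1
    simp only [state] at h1 h2
    rw [h1, add_zero] at e1
    rw [h2, add_zero] at e2
    exact hno t ht _ _ e1 e2
  obtain ⟨t₁, t₂, hlt, ht₂, heq⟩ : ∃ t₁ t₂, t₁ < t₂ ∧ t₂ ≤ K ∧
      (state σ ξ (i + t₁), state σ ξ (j + t₁)) = (state σ ξ (i + t₂), state σ ξ (j + t₂)) := by
    obtain ⟨x, hx, y, hy, hxy, he⟩ := Finset.exists_ne_map_eq_of_card_lt_of_maps_to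
      (s := Finset.range (K + 1)) (t := F ×ˢ F)
      (f := fun t => (state σ ξ (i + t), state σ ξ (j + t)))
      (by simp [K]) (fun t _ => by simp only [Finset.coe_product]; exact ⟨hF _, hF _⟩)
    simp only [Finset.mem_range] at hx hy
    rcases lt_or_gt_of_ne hxy with h | h
    · exact ⟨x, y, h, by omega, he⟩
    · exact ⟨y, x, h, by omega, he.symm⟩
  have hper : ∀ s, t₂ + s < N → state σ ξ (i + (t₁ + s)) = state σ ξ (i + (t₂ + s)) ∧
      state σ ξ (j + (t₁ + s)) = state σ ξ (j + (t₂ + s)) := by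
    intro s
    induction s with
    | zero => exact fun _ => Prod.mk.inj heq
    | succ s ih =>
      intro hs
      obtain ⟨ih1, ih2⟩ := ih (by omega)
      exact hfix.state_succ_eq hwm hpos ih1 ih2 (hij (t₁ + s + 1) (by omega))
        (hij (t₂ + s + 1) (by omega)) (hns (t₁ + s + 1) (by omega))
  have hle : P (t₂ - t₁) ≤ ∑ p ∈ Finset.range (K + 1), P p :=
    Finset.single_le_sum (f := P) (fun _ _ => Nat.zero_le _) (by simp; omega)
  obtain ⟨s, hs, hne⟩ := hP (t₂ - t₁) (by omega) (i + t₁)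
  apply hne
  have e : i + t₁ + s + (t₂ - t₁) = i + (t₂ + s) := by omega
  rw [e, add_assoc]
  exact (hfix.apply_eq_of_state_eq hpos (hper s (by omega)).1).symm

/-! ### Left extension of blocks -/

lemma pow_succ' (A : List Bool) (m : ℕ) : pow A (m + 1) = A ++ pow A m := by
  induction m with
  | zero => simp [pow]
  | succ m ih =>
    rw [pow, ih, List.append_assoc, ← pow, ih]

lemma W0Spec.suffix_append_letter {W0 : List Bool} {δ : Bool → Bool} (hW0 : W0Spec σ W0 δ)
    (hpos : ∀ c, 1 ≤ (σ c).length) (c : Bool) : (δ c :: W0) <:+ W0 ++ σ c := by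
  obtain ⟨m, -, hm⟩ := hW0.2 c
  have h1 : W0 ++ σ c <:+ pow (σ c) (m + 1) := by
    obtain ⟨u, hu⟩ := (List.suffix_cons _ _).trans hm
    exact ⟨u, by rw [pow, ← hu, List.append_assoc]⟩
  have h2 : (δ c :: W0) <:+ pow (σ c) (m + 1) := by
    rw [pow_succ']
    exact hm.trans (List.suffix_append _ _)
  refine List.suffix_of_suffix_length_le h2 h1 ?_
  have := hpos c
  simp only [List.length_cons, List.length_append]
  omega

lemma W0Spec.suffix_append_subst {W0 : List Bool} {δ : Bool → Bool} (hW0 : W0Spec σ W0 δ)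
    (hpos : ∀ c, 1 ≤ (σ c).length) (w : List Bool) : W0 <:+ W0 ++ subst σ w := by
  induction w with
  | nil => simp [subst]
  | cons c w ih =>
    have h := (List.suffix_cons _ _).trans (hW0.suffix_append_letter hpos c)
    obtain ⟨u, hu⟩ := h
    refine ih.trans ⟨u, ?_⟩
    rw [subst, ← List.append_assoc, ← List.append_assoc, hu]

lemma W0Spec.suffix_subst {W0 : List Bool} {δ : Bool → Bool} (hW0 : W0Spec σ W0 δ)
    (hpos : ∀ c, 1 ≤ (σ c).length) (w : List Bool) (c : Bool)
    (hlen : W0.length < (subst σ (w ++ [c])).length) : (δ c :: W0) <:+ subst σ (w ++ [c]) := by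
  have h1 : W0 ++ σ c <:+ W0 ++ subst σ (w ++ [c]) := by
    obtain ⟨u, hu⟩ := hW0.suffix_append_subst hpos w
    refine ⟨u, ?_⟩
    rw [subst_append, subst_singleton, ← List.append_assoc, ← List.append_assoc, hu]
  exact List.suffix_of_suffix_length_le ((hW0.suffix_append_letter hpos c).trans h1)
    (List.suffix_append _ _) (by simpa using hlen)

/-- The letters of `ξ` to the left of the end of a block `σ(ξ k)` read `δ (ξ k) · W₀`. -/
lemma W0Spec.wordAt_cut_succ {W0 : List Bool} {δ : Bool → Bool} (hW0 : W0Spec σ W0 δ)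
    (hpos : ∀ c, 1 ≤ (σ c).length) (hfix : IsFixedPoint σ ξ) (k : ℕ)
    (hlen : W0.length < cut σ ξ (k + 1)) :
    δ (ξ k) :: W0 = wordAt ξ (cut σ ξ (k + 1) - (W0.length + 1)) (W0.length + 1) := by
  have e : wordAt ξ 0 (k + 1) = wordAt ξ 0 k ++ [ξ k] := by simpa using wordAt_succ ξ 0 k
  have h := hW0.suffix_subst hpos (wordAt ξ 0 k) (ξ k) (by rwa [← e])
  rw [← e, hfix (k + 1)] at h
  exact (eq_wordAt_of_suffix h).2

/-! ### Desubstitution of left special factors -/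

/-- From a common cutting point, two occurrences of a word are decoded in the same way. -/
lemma IsFixedPoint.decode_eq (hfix : IsFixedPoint σ ξ) (hwm : WellMarked σ) {k l q : ℕ}
    (hkl : ∀ t < q, ξ (cut σ ξ k + t) = ξ (cut σ ξ l + t)) (h : ℕ)
    (hh : ∀ s < h, cut σ ξ (k + s) < cut σ ξ k + q) : wordAt ξ k h = wordAt ξ l h := by
  induction h with
  | zero => rfl
  | succ h ih =>
    have ih' := ih fun s hs => hh s (by omega)
    rw [wordAt_succ, wordAt_succ, ih', ← hfix.apply_cut hwm (k + h),
      ← hfix.apply_cut hwm (l + h)]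
    have h1 := hh h (by omega)
    rw [cut_add] at h1 ⊢
    rw [cut_add, ← ih', hkl _ (by omega)]

/-- The leftmost common cutting point of two occurrences of a word that are preceded by
different letters is preceded by different blocks. -/
lemma IsFixedPoint.exists_branching_cut (hfix : IsFixedPoint σ ξ)
    (hpos : ∀ c, 1 ≤ (σ c).length) {i j n : ℕ} (hne : ξ i ≠ ξ j)
    (hex : ∃ t < n, ∃ k l, cut σ ξ k = i + 1 + t ∧ cut σ ξ l = j + 1 + t) :
    ∃ t < n, ∃ k l, cut σ ξ (k + 1) = i + 1 + t ∧ cut σ ξ (l + 1) = j + 1 + t ∧ ξ k ≠ ξ l := by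
  classical
  obtain ⟨ht, k, l, hk, hl⟩ := Nat.find_spec hex
  have hmin := fun m => Nat.find_min hex (m := m)
  set t := Nat.find hex
  obtain _ | k := k
  · rw [cut_zero] at hk
    omega
  obtain _ | l := l
  · rw [cut_zero] at hl
    omega
  refine ⟨t, ht, k, l, hk, hl, fun hkl => ?_⟩
  have ek := hk
  have el := hl
  rw [cut_succ] at ek el
  rw [← hkl] at el
  by_cases hm : (σ (ξ k)).length ≤ t
  · exact hmin (t - (σ (ξ k)).length) (by have := hpos (ξ k); omega)
      ⟨by omega, k, l, by omega, by omega⟩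
  · have g1 := hfix.getElem?_map_letter k (r := (σ (ξ k)).length - (t + 1)) (by omega)
    have g2 := hfix.getElem?_map_letter l (r := (σ (ξ k)).length - (t + 1))
      (by rw [← hkl]; omega)
    rw [← hkl, g1] at g2
    apply hne
    have e1 : cut σ ξ k + ((σ (ξ k)).length - (t + 1)) = i := by omega
    have e2 : cut σ ξ l + ((σ (ξ k)).length - (t + 1)) = j := by omega
    rw [e1, e2] at g2
    simpa using g2

lemma LeftSpecial.of_ne {k l h : ℕ} (hne : ξ k ≠ ξ l)
    (heq : wordAt ξ (k + 1) h = wordAt ξ (l + 1) h) : LeftSpecial ξ (wordAt ξ (k + 1) h) := by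
  intro c
  by_cases hc : c = ξ k
  · rw [hc, ← wordAt_succ']
    exact isFactor_wordAt _ _ _
  · have hc' : c = ξ l := by
      cases c <;> cases h1 : ξ k <;> cases h2 : ξ l <;> simp_all
    rw [hc', heq, ← wordAt_succ']
    exact isFactor_wordAt _ _ _

/-- A long left special factor `W` is a prefix of `T(V)` for a shorter left special factor
`V`. -/
lemma IsFixedPoint.exists_shorter_leftSpecial (hfix : IsFixedPoint σ ξ) (hwm : WellMarked σ)
    (hprim : Primitive σ) {W0 : List Bool} {δ : Bool → Bool} (hW0 : W0Spec σ W0 δ)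
    (hnp : ¬ UltPeriodic ξ) :
    ∃ L : ℕ, ∀ W, LeftSpecial ξ W → L < W.length →
      ∃ V, IsFactor ξ V ∧ LeftSpecial ξ V ∧ V.length < W.length ∧ W <+: T σ W0 V := by
  have h2 := hwm.two_le_length hprim
  have hpos : ∀ c, 1 ≤ (σ c).length := fun c => one_le_two.trans (h2 c)
  obtain ⟨N, hN⟩ := hfix.exists_common_cut hwm hprim hnp
  refine ⟨N + 1, fun W hW hlen => ?_⟩
  obtain ⟨i, hi, hWi⟩ := hfix.exists_late_occurrence h2 hprim (hW false) W0.length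
  obtain ⟨j, hj, hWj⟩ := hfix.exists_late_occurrence h2 hprim (hW true) W0.length
  rw [List.length_cons, wordAt_succ', List.cons.injEq] at hWi hWj
  obtain ⟨hi0, hWi⟩ := hWi
  obtain ⟨hj0, hWj⟩ := hWj
  have hij := (wordAt_eq_iff ξ (i + 1) (j + 1) W.length).1 (hWi.symm.trans hWj)
  have hne : ξ i ≠ ξ j := by simp [← hi0, ← hj0]
  obtain ⟨t, htN, k, l, hk, hl, hkl⟩ := hfix.exists_branching_cut hpos hne
    (hN (i + 1) (j + 1) fun t ht => hij t (by omega))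
  have hδ : δ (ξ k) ≠ δ (ξ l) := by
    have h0 := hW0.1
    revert hkl
    cases ξ k <;> cases ξ l
    · simp
    · exact fun _ => h0
    · exact fun _ => h0.symm
    · simp
  have wk := hW0.wordAt_cut_succ hpos hfix k (by omega)
  have wl := hW0.wordAt_cut_succ hpos hfix l (by omega)
  rw [wordAt_succ', List.cons.injEq] at wk wl
  have hagree := (wordAt_eq_iff _ _ _ _).1 (wk.2.symm.trans wl.2)
  have ht : t = W0.length := by
    rcases lt_trichotomy t W0.length with hlt | heq | hgt
    · refine absurd (hagree (W0.length - (t + 1)) (by omega)) ?_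
      rw [hk, hl]
      convert hne using 2 <;> congr 1 <;> omega
    · exact heq
    · refine absurd (hij (t - (W0.length + 1)) (by omega)) ?_
      rw [wk.1, wl.1, hk, hl] at hδ
      convert hδ using 2 <;> congr 1 <;> omega
  have hex : ∃ h, i + 1 + W.length ≤ cut σ ξ (k + 1 + h) :=
    ⟨i + 1 + W.length, le_trans (by omega) (le_cut hpos _)⟩
  classical
  set h := Nat.find hex
  have hend : i + 1 + W.length ≤ cut σ ξ (k + 1 + h) := Nat.find_spec hex
  have hbefore : ∀ s < h, cut σ ξ (k + 1 + s) < i + 1 + W.length :=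
    fun s hs => not_le.1 (Nat.find_min hex hs)
  have hdec : wordAt ξ (k + 1) h = wordAt ξ (l + 1) h := by
    refine hfix.decode_eq hwm (q := W.length - t) (fun s hs => ?_) h fun s hs => ?_
    · rw [hk, hl, add_assoc (i + 1), add_assoc (j + 1)]
      exact hij (t + s) (by omega)
    · have := hbefore s hs
      omega
  refine ⟨wordAt ξ (k + 1) h, isFactor_wordAt _ _ _, LeftSpecial.of_ne hkl hdec, ?_, ?_⟩
  · rw [length_wordAt]
    rcases Nat.eq_zero_or_pos h with h0 | h0
    · omega
    · have h3 := hbefore (h - 1) (by omega)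
      have h4 := two_mul_length_le_subst h2 (wordAt ξ (k + 1) (h - 1))
      rw [length_wordAt] at h4
      rw [cut_add] at h3
      omega
  · have hW0i : W0 = wordAt ξ (i + 1) W0.length := by
      refine wk.2.trans ?_
      congr 1
      omega
    rw [cut_add] at hend
    have hT : T σ W0 (wordAt ξ (k + 1) h) =
        wordAt ξ (i + 1) (W0.length + (subst σ (wordAt ξ (k + 1) h)).length) := by
      rw [T, wordAt_add, ← hW0i, ← ht, ← hk, ← hfix.subst_wordAt]
    rw [hT, hWi]
    exact wordAt_prefix ξ (i + 1) (by omega)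

lemma T_mono (σ : Bool → List Bool) (W0 : List Bool) {U V : List Bool} (h : U <+: V) :
    T σ W0 U <+: T σ W0 V := by
  obtain ⟨u, rfl⟩ := h
  exact ⟨subst σ u, by rw [T, T, subst_append, List.append_assoc]⟩

end Subst

/-- There exists `L` such that every left special factor of `ξ` is a
prefix of `Tⁿ(W′)` for some `n` and some left special factor `W′` with `|W′| ≤ L`. -/
theorem statement9 (σ : Bool → List Bool) (hne : NonErasing σ)
    (hwm : WellMarked σ) (hprim : Primitive σ)
    (hAB : σ false ++ σ true ≠ σ true ++ σ false)
    (W0 : List Bool) (δ : Bool → Bool) (hW0 : W0Spec σ W0 δ)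
    (ξ : ℕ → Bool) (hfix : IsFixedPoint σ ξ) (hnp : ¬ UltPeriodic ξ) :
    ∃ L : ℕ, ∀ W, IsFactor ξ W → LeftSpecial ξ W →
      ∃ (n : ℕ) (W' : List Bool), IsFactor ξ W' ∧ LeftSpecial ξ W' ∧
        W'.length ≤ L ∧ W <+: (T σ W0)^[n] W' := by
  obtain ⟨L, hL⟩ := hfix.exists_shorter_leftSpecial hwm hprim hW0 hnp
  refine ⟨L, fun W hWf hW => ?_⟩
  induction hn : W.length using Nat.strong_induction_on generalizing W with
  | _ n ih =>
    rcases le_or_gt W.length L with hle | hgt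
    · exact ⟨0, W, hWf, hW, hle, List.prefix_rfl⟩
    · obtain ⟨V, hVf, hV, hlt, hpre⟩ := hL W hW hgt
      obtain ⟨m, W', hf', hs', hl', hp'⟩ := ih V.length (hn ▸ hlt) V hVf hV rfl
      refine ⟨m + 1, W', hf', hs', hl', ?_⟩
      rw [Function.iterate_succ_apply']
      exact hpre.trans (T_mono σ W0 hp')
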